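/- Let n be a positive integer not divisible by p, let h ∈ F_q[x] satisfy gcd(h(x), (x^n − 1)/(x − 1)) = 1 in F_q[x], and let b(x) = Σ_{i=0}^{m} b_i x^i ∈ F_q[x] be a permutation polynomial of F_q. Then for every θ_0, ..., θ_{q−1} ∈ F_{q^n}, the polynomial P(x) = L_h(x) − (h(1)/n)·Tr_{q^n/q}(x) + Σ_{i=0}^{m} (b_i/n)·Tr_{q^n/q}(x)^i + Σ_{i=0}^{q−1} (θ_i^q − θ_i)·Tr_{q^n/q}(x)^i is a permutation polynomial of F_{q^n}. If in addition gcd(h(x) + 1, (x^n − 1)/(x − 1)) = 1 and b is a complete permutation polynomial of F_q, then P is a complete permutation polynomial of F_{q^n}. -/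

import Mathlib

open Polynomial

/-- The linearized `q`-associate of `f ∈ 𝔽_q[x]`, evaluated on an extension field:
`L_f(y) = Σ aᵢ y^(qⁱ)` where `q` is the cardinality of `Fq`. -/
noncomputable def Lq {Fq Fqn : Type*} [Field Fq] [Fintype Fq] [Field Fqn] [Algebra Fq Fqn]
    (f : Polynomial Fq) (y : Fqn) : Fqn :=
  f.sum fun i a => algebraMap Fq Fqn a * y ^ (Fintype.card Fq) ^ i

/-- `T_n[f](x) = Σ Tr(aᵢ) xⁱ ∈ 𝔽_q[x]` for `f = Σ aᵢ xⁱ ∈ 𝔽_{qⁿ}[x]`, where `Tr` is the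
field trace from `𝔽_{qⁿ}` onto `𝔽_q`. -/
noncomputable def Tn (Fq : Type*) {Fqn : Type*} [Field Fq] [Field Fqn] [Algebra Fq Fqn]
    (f : Polynomial Fqn) : Polynomial Fq :=
  f.sum fun i a => C (Algebra.trace Fq Fqn a) * X ^ i

lemma frobeniusAlgHom_toLinearMap_pow_apply {Fq Fqn : Type*} [Field Fq] [Fintype Fq]
    [Field Fqn] [Algebra Fq Fqn] (i : ℕ) (y : Fqn) :
    ((FiniteField.frobeniusAlgHom Fq Fqn).toLinearMap ^ i) y = y ^ Fintype.card Fq ^ i := by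
  induction i with
  | zero => simp
  | succ k ih =>
    rw [pow_succ', Module.End.mul_apply, ih]
    simp only [AlgHom.toLinearMap_apply, FiniteField.coe_frobeniusAlgHom, ← pow_mul, pow_succ]

/-- `L_f` is the evaluation of `f` at the Frobenius endomorphism. -/
lemma Lq_eq_aeval_frobenius {Fq Fqn : Type*} [Field Fq] [Fintype Fq] [Field Fqn]
    [Algebra Fq Fqn] (f : Polynomial Fq) (y : Fqn) :
    Lq f y = aeval (FiniteField.frobeniusAlgHom Fq Fqn).toLinearMap f y := by
  rw [Lq, aeval_eq_sum_range, sum_over_range _ (by simp), LinearMap.sum_apply]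
  exact Finset.sum_congr rfl fun i _ => by
    rw [LinearMap.smul_apply, frobeniusAlgHom_toLinearMap_pow_apply, Algebra.smul_def]

lemma trace_pow_card {Fq Fqn : Type*} [Field Fq] [Fintype Fq] [Field Fqn]
    [Algebra Fq Fqn] [FiniteDimensional Fq Fqn] (y : Fqn) :
    Algebra.trace Fq Fqn (y ^ Fintype.card Fq) = Algebra.trace Fq Fqn y :=
  Algebra.trace_eq_of_algEquiv (FiniteField.frobeniusAlgEquivOfAlgebraic Fq Fqn) y

lemma trace_Lq {Fq Fqn : Type*} [Field Fq] [Fintype Fq] [Field Fqn]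
    [Algebra Fq Fqn] [FiniteDimensional Fq Fqn] (f : Polynomial Fq) (y : Fqn) :
    Algebra.trace Fq Fqn (Lq f y) = f.eval 1 * Algebra.trace Fq Fqn y := by
  have hpow (i : ℕ) : Algebra.trace Fq Fqn (y ^ Fintype.card Fq ^ i) =
      Algebra.trace Fq Fqn y := by
    induction i with
    | zero => simp
    | succ k ih => rw [pow_succ, pow_mul, trace_pow_card, ih]
  rw [Lq, Polynomial.sum, map_sum, eval_eq_sum, Polynomial.sum, Finset.sum_mul]
  exact Finset.sum_congr rfl fun i _ => by
    rw [← Algebra.smul_def, map_smul, hpow, smul_eq_mul, one_pow, mul_one]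

lemma X_pow_sub_one_div_X_sub_one {F : Type*} [Field F] (n : ℕ) :
    ((X ^ n - 1) / (X - 1) : Polynomial F) = ∑ i ∈ Finset.range n, X ^ i := by
  have hX : (X - 1 : Polynomial F) ≠ 0 := X_sub_C_ne_zero (1 : F)
  rw [← mul_geom_sum, mul_div_cancel_left₀ _ hX]

/-- The linearized associate of `(x^n - 1) / (x - 1)` is the trace. -/
lemma Lq_X_pow_sub_one_div {Fq Fqn : Type*} [Field Fq] [Fintype Fq] [Field Fqn]
    [Algebra Fq Fqn] [FiniteDimensional Fq Fqn] (y : Fqn) :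
    Lq ((X ^ Module.finrank Fq Fqn - 1) / (X - 1) : Polynomial Fq) y =
      algebraMap Fq Fqn (Algebra.trace Fq Fqn y) := by
  have : Finite Fqn := Module.finite_of_finite Fq
  rw [Lq_eq_aeval_frobenius, X_pow_sub_one_div_X_sub_one, map_sum, LinearMap.sum_apply,
    FiniteField.algebraMap_trace_eq_sum_pow, Nat.card_eq_fintype_card]
  exact Finset.sum_congr rfl fun i _ => by
    rw [map_pow, aeval_X, frobeniusAlgHom_toLinearMap_pow_apply]

lemma eq_zero_of_Lq_eq_zero_of_trace_eq_zero {Fq Fqn : Type*} [Field Fq] [Fintype Fq]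
    [Field Fqn] [Algebra Fq Fqn] [FiniteDimensional Fq Fqn] {f : Polynomial Fq}
    (hf : IsCoprime f ((X ^ Module.finrank Fq Fqn - 1) / (X - 1))) {y : Fqn}
    (hL : Lq f y = 0) (htr : Algebra.trace Fq Fqn y = 0) : y = 0 := by
  have hg := Lq_X_pow_sub_one_div (Fq := Fq) y
  rw [htr, map_zero, Lq_eq_aeval_frobenius] at hg
  rw [Lq_eq_aeval_frobenius] at hL
  obtain ⟨u, v, huv⟩ := hf
  have := congrArg (fun g => aeval (FiniteField.frobeniusAlgHom Fq Fqn).toLinearMap g y) huv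
  simpa [hL, hg] using this.symm

/-- A map with linear part `L_f` on the kernel of the trace, inducing an injective map `β` on
traces, is a bijection. -/
lemma bijective_Lq_add_of_injective {Fq Fqn : Type*} [Field Fq] [Fintype Fq]
    [Field Fqn] [Algebra Fq Fqn] [FiniteDimensional Fq Fqn]
    (hn : (Module.finrank Fq Fqn : Fq) ≠ 0) {f : Polynomial Fq}
    (hf : IsCoprime f ((X ^ Module.finrank Fq Fqn - 1) / (X - 1)))
    {β : Fq → Fq} (hβ : Function.Injective β) {γ : Fq → Fqn}
    (hγ : ∀ t, Algebra.trace Fq Fqn (γ t) = 0) :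
    Function.Bijective fun x : Fqn =>
      Lq f x + algebraMap Fq Fqn ((β (Algebra.trace Fq Fqn x) -
        f.eval 1 * Algebra.trace Fq Fqn x) / Module.finrank Fq Fqn) +
        γ (Algebra.trace Fq Fqn x) := by
  have : Finite Fqn := Module.finite_of_finite Fq
  refine Finite.injective_iff_bijective.mp fun x y hxy => ?_
  have htr : Algebra.trace Fq Fqn x = Algebra.trace Fq Fqn y := by
    apply hβ
    have := congrArg (Algebra.trace Fq Fqn) hxy
    simpa only [map_add, trace_Lq, hγ, Algebra.trace_algebraMap, nsmul_eq_mul,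
      mul_div_cancel₀ _ hn, add_sub_cancel, add_zero] using this
  have hL : Lq f x = Lq f y := by simpa [htr] using hxy
  refine sub_eq_zero.mp (eq_zero_of_Lq_eq_zero_of_trace_eq_zero hf ?_ (by simp [htr]))
  rw [Lq_eq_aeval_frobenius] at hL ⊢
  rw [map_sub, hL, Lq_eq_aeval_frobenius, sub_self]

/-- Let `p ∤ n`, let `h ∈ 𝔽_q[x]` with `gcd(h, (xⁿ-1)/(x-1)) = 1`, and let
`b = Σ_{i=0}^m bᵢ xⁱ` be a PP of `𝔽_q`. For any `θ₀, …, θ_{q-1} ∈ 𝔽_{qⁿ}`, the polynomial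
`P(x) = L_h(x) - (h(1)/n)·Tr(x) + Σᵢ (bᵢ/n)·Tr(x)ⁱ + Σᵢ (θᵢ^q - θᵢ)·Tr(x)ⁱ` permutes
`𝔽_{qⁿ}`. If moreover `gcd(h+1, (xⁿ-1)/(x-1)) = 1` and `b` is a CPP of `𝔽_q`, then
`P` is a CPP of `𝔽_{qⁿ}`. -/
theorem PP_and_CPP_explicit_construction {Fq Fqn : Type*} [Field Fq] [Fintype Fq]
    [DecidableEq Fq] [Field Fqn] [Algebra Fq Fqn]
    {n : ℕ} (hn : 0 < n) (hrank : Module.finrank Fq Fqn = n)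
    (hpn : ¬ ringChar Fq ∣ n)
    (h : Polynomial Fq) (hgcd : gcd h ((X ^ n - 1) / (X - 1) : Polynomial Fq) = 1)
    (b : Polynomial Fq) (hb : Function.Bijective fun c : Fq => b.eval c)
    (θ : Fin (Fintype.card Fq) → Fqn)
    (P : Fqn → Fqn)
    (hP : P = fun x : Fqn =>
      Lq h x -
        algebraMap Fq Fqn (h.eval 1 / (n : Fq)) *
          algebraMap Fq Fqn (Algebra.trace Fq Fqn x) +
        (∑ i ∈ Finset.range (b.natDegree + 1),
          algebraMap Fq Fqn (b.coeff i / (n : Fq)) *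
            algebraMap Fq Fqn (Algebra.trace Fq Fqn x) ^ i) +
        ∑ i : Fin (Fintype.card Fq),
          (θ i ^ Fintype.card Fq - θ i) *
            algebraMap Fq Fqn (Algebra.trace Fq Fqn x) ^ (i : ℕ)) :
    Function.Bijective P ∧
      ((gcd (h + 1) ((X ^ n - 1) / (X - 1) : Polynomial Fq) = 1 ∧
          Function.Bijective fun c : Fq => b.eval c + c) →
        Function.Bijective fun x : Fqn => P x + x) := by
  subst hrank
  have : FiniteDimensional Fq Fqn := Module.finite_of_finrank_pos hn
  have hn' : (Module.finrank Fq Fqn : Fq) ≠ 0 := fun h0 => hpn (ringChar.dvd h0)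
  have hγ (t : Fq) : Algebra.trace Fq Fqn (∑ i : Fin (Fintype.card Fq),
      (θ i ^ Fintype.card Fq - θ i) * algebraMap Fq Fqn t ^ (i : ℕ)) = 0 := by
    rw [map_sum]
    refine Finset.sum_eq_zero fun i _ => ?_
    rw [← map_pow, mul_comm, ← Algebra.smul_def, map_smul, map_sub, trace_pow_card, sub_self,
      smul_zero]
  have hsum (t : Fq) : ∑ i ∈ Finset.range (b.natDegree + 1),
      algebraMap Fq Fqn (b.coeff i / (Module.finrank Fq Fqn : Fq)) * algebraMap Fq Fqn t ^ i =
      algebraMap Fq Fqn (b.eval t / Module.finrank Fq Fqn) := by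
    rw [eval_eq_sum_range, Finset.sum_div, map_sum]
    exact Finset.sum_congr rfl fun i _ => by rw [← map_pow, ← map_mul, div_mul_eq_mul_div]
  simp only [hsum] at hP
  subst hP
  constructor
  · convert bijective_Lq_add_of_injective hn' ((gcd_isUnit_iff _ _).mp (hgcd ▸ isUnit_one))
      hb.injective hγ using 1
    funext x
    simp only [map_div₀, map_sub, map_mul]
    ring
  · rintro ⟨hgcd', hb'⟩
    convert bijective_Lq_add_of_injective hn' ((gcd_isUnit_iff _ _).mp (hgcd' ▸ isUnit_one))
      hb'.injective hγ using 1
    funext x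
    have hL : Lq (h + 1) x = Lq h x + x := by simp [Lq_eq_aeval_frobenius]
    simp only [hL, map_div₀, map_sub, map_mul, map_add, eval_add, eval_one, map_one]
    ring
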